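/- arXiv:0809.4897 — 4 statements merged into one kernel-verified Lean document; each statement's English description precedes it below -/
import Mathlib

section
/- Let Λ be a finite dimensional algebra with gl.dim Λ ≤ n and X ∈ mod Λ. If X has no non-zero projective direct summands and Ext^i_Λ(X,Λ)=0 for all 0<i<n, then also Hom_Λ(X,Λ)=0. -/
noncomputable section

open CategoryTheory ModuleCat Limits Opposite

universe u

variable (k : Type u) [Field k] (A : Type u) [Ring A] [Algebra k A]

/-- The Ext group `Ext_A^n(X, Y)` of (left) `A`-modules, as a `k`-module. -/
def extGrp (n : ℕ) (X Y : ModuleCat.{u} A) : ModuleCat.{u} k :=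
  ((Ext k (ModuleCat.{u} A) n).obj (op X)).obj Y

/-- Vanishing of `Ext^n_A(X,Y)`. -/
def extZero (n : ℕ) (X Y : ModuleCat.{u} A) : Prop :=
  Subsingleton (extGrp k A n X Y)

/-- The global dimension of `A` is at most `d`. -/
def gldimLE (d : ℕ) : Prop :=
  ∀ i : ℕ, d < i → ∀ X Y : ModuleCat.{u} A, extZero k A i X Y

/-- The projective dimension of `X` is at most `d`. -/
def pdLE (X : ModuleCat.{u} A) (d : ℕ) : Prop :=
  ∀ i : ℕ, d < i → ∀ Y : ModuleCat.{u} A, extZero k A i X Y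

/-- The injective dimension of `X` is at most `d`. -/
def idLE (X : ModuleCat.{u} A) (d : ℕ) : Prop :=
  ∀ i : ℕ, d < i → ∀ Y : ModuleCat.{u} A, extZero k A i Y X

/-- `X` belongs to the additive closure `add S` of the class of modules `S`. -/
def InAdd (S : Set (ModuleCat.{u} A)) (X : ModuleCat.{u} A) : Prop :=
  ∃ (Y : ModuleCat.{u} A) (m : ℕ) (f : Fin m → ModuleCat.{u} A),
    (∀ i, f i ∈ S) ∧ Nonempty ((X ⊞ Y) ≅ ⨁ f)

/-- `X` is a direct summand of `M`. -/
def IsSummand (X M : ModuleCat.{u} A) : Prop :=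
  ∃ Y : ModuleCat.{u} A, Nonempty (M ≅ X ⊞ Y)

/-- `X` is an indecomposable (in particular nonzero) module. -/
def Indec (X : ModuleCat.{u} A) : Prop :=
  ¬ IsZero X ∧ ∀ Y Z : ModuleCat.{u} A, Nonempty (X ≅ Y ⊞ Z) → IsZero Y ∨ IsZero Z

section Helpers

variable {k} {A}

open Abelian in
lemma ext_sub_of_extZero (i : ℕ) (X Y : ModuleCat.{u} A) (h : extZero k A (i+1) X Y) :
    Subsingleton (Abelian.Ext.{u} X Y (i+1)) := by
  let P : ProjectiveResolution X := projectiveResolution X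
  have hz : IsZero ((P.complex.linearYonedaObj k Y).homology (i+1)) := by
    refine IsZero.of_iso ?_ (P.isoExt (R := k) (i+1) Y).symm
    have : Subsingleton ((((_root_.Ext k (ModuleCat.{u} A) (i+1)).obj (op X)).obj Y) :
      ModuleCat.{u} k) := h
    exact ModuleCat.isZero_of_subsingleton _
  rw [← HomologicalComplex.exactAt_iff_isZero_homology,
    HomologicalComplex.exactAt_iff' _ i (i+1) (i+2) (by simp) (by simp),
    ShortComplex.moduleCat_exact_iff] at hz
  refine subsingleton_of_forall_eq 0 fun e => ?_
  obtain ⟨f, hf, rfl⟩ := P.extMk_surjective e (i+2) rfl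
  rw [P.extMk_eq_zero_iff f (i+2) rfl hf i rfl]
  obtain ⟨g, hg⟩ := hz f hf
  exact ⟨g, hg⟩

lemma ext_free {X : ModuleCat.{u} A} {i : ℕ}
    (h : Subsingleton (Abelian.Ext.{u} X (ModuleCat.of A A) i)) (m : ℕ)
    (e : Abelian.Ext.{u} X (ModuleCat.of A (Fin m → A)) i) : e = 0 := by
  have key : 𝟙 (ModuleCat.of A (Fin m → A)) = ∑ j : Fin m,
      (ModuleCat.ofHom (LinearMap.proj j) : ModuleCat.of A (Fin m → A) ⟶ ModuleCat.of A A) ≫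
        ModuleCat.ofHom (LinearMap.single A (fun _ => A) j) := by
    ext x : 2
    simp [ModuleCat.hom_sum]
    ext j
    simp [Pi.single_apply]
  have h2 : e = e.comp (Abelian.Ext.mk₀ (𝟙 _)) (add_zero _) := by simp
  rw [h2, key, Abelian.Ext.mk₀_sum, Abelian.Ext.comp_sum]
  refine Finset.sum_eq_zero fun j _ => ?_
  rw [← Abelian.Ext.mk₀_comp_mk₀, ← Abelian.Ext.comp_assoc_of_third_deg_zero,
    Subsingleton.elim (e.comp _ _) 0, Abelian.Ext.zero_comp]

/-- The short complex of a surjection. -/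
def kerSeq {F K : ModuleCat.{u} A} (p : F ⟶ K) : ShortComplex (ModuleCat.{u} A) :=
  ShortComplex.mk (ModuleCat.ofHom (LinearMap.ker p.hom).subtype) p (by ext x; exact x.2)

lemma kerSeq_exact {F K : ModuleCat.{u} A} (p : F ⟶ K) (hp : Function.Surjective p) :
    (kerSeq p).ShortExact where
  exact := by
    rw [ShortComplex.moduleCat_exact_iff]
    intro x hx
    exact ⟨⟨x, hx⟩, rfl⟩
  mono_f := (ModuleCat.mono_iff_injective _).2 Subtype.val_injective
  epi_g := (ModuleCat.epi_iff_surjective _).2 hp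

lemma free_proj (m : ℕ) : Projective (ModuleCat.of A (Fin m → A)) :=
  (IsProjective.iff_projective (R := A) (Fin m → A)).1 inferInstance

lemma ext_pd [IsNoetherianRing A] {X : ModuleCat.{u} A} (n : ℕ)
    (h : ∀ i, 0 < i → i < n → Subsingleton (Abelian.Ext.{u} X (ModuleCat.of A A) i)) (j : ℕ) :
    ∀ (K : ModuleCat.{u} A), Module.Finite A K → HasProjectiveDimensionLT K (j+1) →
    ∀ i, 0 < i → i + j < n → Subsingleton (Abelian.Ext.{u} X K i) := by
  induction j with
  | zero =>
    intro K hK hpd i hi hin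
    obtain ⟨m, p, hp⟩ := Module.Finite.exists_fin' A K
    have : Projective K := projective_iff_hasProjectiveDimensionLT_one.2 hpd
    let q : ModuleCat.of A (Fin m → A) ⟶ K := ModuleCat.ofHom p
    have : Epi q := (ModuleCat.epi_iff_surjective _).2 hp
    refine subsingleton_of_forall_eq 0 fun e => ?_
    have h2 : e = e.comp (Abelian.Ext.mk₀ (𝟙 _)) (add_zero _) := by simp
    rw [h2, ← Projective.factorThru_comp (𝟙 K) q, ← Abelian.Ext.mk₀_comp_mk₀,
      ← Abelian.Ext.comp_assoc_of_third_deg_zero, ext_free (h i hi (by omega)) m (e.comp _ _),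
      Abelian.Ext.zero_comp]
  | succ j ih =>
    intro K hK hpd i hi hin
    obtain ⟨m, p, hp⟩ := Module.Finite.exists_fin' A K
    let q : ModuleCat.of A (Fin m → A) ⟶ K := ModuleCat.ofHom p
    have hq := kerSeq_exact q hp
    have hpd' := (hq.hasProjectiveDimensionLT_X₃_iff j (free_proj m)).1 hpd
    have hfin : Module.Finite A (kerSeq q).X₁ :=
      inferInstanceAs (Module.Finite A (LinearMap.ker p))
    have := ih _ hfin hpd' (i+1) (by omega) (by omega)
    refine subsingleton_of_forall_eq 0 fun e => ?_
    obtain ⟨y, hy⟩ := Abelian.Ext.covariant_sequence_exact₃ X hq e rfl (Subsingleton.elim _ _)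
    have hy0 : y = 0 := ext_free (h i hi (by omega)) m y
    rw [← hy, hy0, Abelian.Ext.zero_comp]
    rfl

lemma lift_free [IsNoetherianRing A] {X : ModuleCat.{u} A} (n : ℕ) (hn : 1 ≤ n)
    (h : ∀ i, 0 < i → i < n → Subsingleton (Abelian.Ext.{u} X (ModuleCat.of A A) i))
    (K : ModuleCat.{u} A) (hpd : HasProjectiveDimensionLT K n)
    (m : ℕ) (q : ModuleCat.of A (Fin m → A) ⟶ K) (hq : Function.Surjective q)
    (f : X ⟶ K) : ∃ g, g ≫ q = f := by
  obtain _ | _ | n := n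
  · omega
  · have : Projective K := projective_iff_hasProjectiveDimensionLT_one.2 hpd
    have : Epi q := (ModuleCat.epi_iff_surjective _).2 hq
    exact ⟨f ≫ Projective.factorThru (𝟙 K) q, by simp⟩
  · have hS := kerSeq_exact q hq
    have hpd' := (hS.hasProjectiveDimensionLT_X₃_iff n (free_proj m)).1 hpd
    have hfin : Module.Finite A (kerSeq q).X₁ :=
      inferInstanceAs (Module.Finite A (LinearMap.ker q.hom))
    have := ext_pd (n+2) h n _ hfin hpd' 1 (by omega) (by omega)
    obtain ⟨φ, hφ⟩ := Abelian.Ext.covariant_sequence_exact₃ X hS (Abelian.Ext.mk₀ f) (zero_add 1)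
      (Subsingleton.elim _ _)
    obtain ⟨φ, rfl⟩ := Abelian.Ext.homEquiv₀.symm.surjective φ
    have h3 : φ ≫ (kerSeq q).g = f :=
      Abelian.Ext.homEquiv₀.symm.injective (by
        simp only [Abelian.Ext.homEquiv₀_symm_apply, Abelian.Ext.mk₀_comp_mk₀] at hφ
        exact hφ)
    exact ⟨φ, h3⟩

lemma exists_univ [IsArtinianRing A] (X : Type u) [AddCommGroup X] [Module A X]
    [Module.Finite A X] : ∃ (m : ℕ) (g : X →ₗ[A] (Fin m → A)),
    ∀ f : X →ₗ[A] A, LinearMap.ker g ≤ LinearMap.ker f := by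
  classical
  obtain ⟨K, ⟨m, g, rfl⟩, hmin⟩ := IsArtinian.set_has_minimal
    (R := A) (M := X) {K | ∃ (m : ℕ) (g : X →ₗ[A] (Fin m → A)), LinearMap.ker g = K}
    ⟨_, 0, 0, rfl⟩
  refine ⟨m, g, fun f x hx => ?_⟩
  by_contra hfx
  let g' : X →ₗ[A] (Fin (m+1) → A) := LinearMap.pi (Fin.cons f fun j => LinearMap.proj j ∘ₗ g)
  have hg' : ∀ y, g' y = 0 ↔ f y = 0 ∧ g y = 0 := by
    intro y
    rw [funext_iff, Fin.forall_fin_succ, funext_iff (f := g y)]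
    simp [g']
  refine hmin _ ⟨m+1, g', rfl⟩ (lt_of_le_of_ne (fun y hy => ((hg' y).1 hy).2) fun heq => ?_)
  have : x ∈ LinearMap.ker g' := heq ▸ hx
  exact hfx ((hg' x).1 this).1

end Helpers

/-- If `gl.dim A ≤ n`, `X` is finitely generated with no nonzero projective
direct summands, and `Ext^i_A(X, A) = 0` for `0 < i < n`, then `Hom_A(X, A) = 0`. -/
theorem hom_to_regular_vanishes
    [FiniteDimensional k A] (n : ℕ) (hn : 1 ≤ n) (hgl : gldimLE k A n)
    (X : ModuleCat.{u} A) (hfg : Module.Finite A X)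
    (hproj : ∀ Y : ModuleCat.{u} A, IsSummand A Y X → Projective Y → IsZero Y)
    (hext : ∀ i : ℕ, 0 < i → i < n → extZero k A i X (ModuleCat.of A A)) :
    ∀ f : X ⟶ ModuleCat.of A A, f = 0 := by
  have hart : IsArtinianRing A := IsArtinianRing.of_finite k A
  have hnoe : IsNoetherianRing A := IsNoetherianRing.of_finite k A
  have hext' : ∀ i, 0 < i → i < n →
      Subsingleton (Abelian.Ext.{u} X (ModuleCat.of A A) i) := by
    intro i hi hin
    obtain _ | i := i
    · omega
    · exact ext_sub_of_extZero i _ _ (hext _ hi hin)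
  have hpd : ∀ Y : ModuleCat.{u} A, HasProjectiveDimensionLT Y (n+1) := by
    intro Y
    refine HasProjectiveDimensionLT.mk fun i hi Z e => ?_
    obtain _ | i := i
    · omega
    · have := ext_sub_of_extZero i Y Z (hgl _ (by omega) Y Z)
      exact Subsingleton.elim _ _
  obtain ⟨m, g, hg⟩ := exists_univ (A := A) X
  -- the image of the universal map
  let I : ModuleCat.{u} A := ModuleCat.of A (LinearMap.range g)
  let S : ShortComplex (ModuleCat.{u} A) := kerSeq (ModuleCat.ofHom (LinearMap.range g).mkQ)
  have hS : S.ShortExact := kerSeq_exact _ (Submodule.mkQ_surjective _)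
  have hpdS : HasProjectiveDimensionLT S.X₁ n := by
    have : HasProjectiveDimensionLT S.X₂ 1 := by
      have : Projective S.X₂ := free_proj m
      infer_instance
    exact hS.hasProjectiveDimensionLT_X₁ n (hasProjectiveDimensionLT_of_ge _ 1 _ hn) (hpd _)
  have hpdI : HasProjectiveDimensionLT I n := by
    have e : S.X₁ ≅ I := (LinearEquiv.ofEq (LinearMap.ker (LinearMap.range g).mkQ)
      (LinearMap.range g) (Submodule.ker_mkQ _)).toModuleIso
    exact hasProjectiveDimensionLT_of_iso e n
  obtain ⟨r, p, hp⟩ := Module.Finite.exists_fin' A (LinearMap.range g)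
  let π : X ⟶ I := ModuleCat.ofHom g.rangeRestrict
  have hπ : Epi π := (ModuleCat.epi_iff_surjective _).2 g.surjective_rangeRestrict
  let q : ModuleCat.of A (Fin r → A) ⟶ I := ModuleCat.ofHom p
  obtain ⟨h, hh⟩ := lift_free n hn hext' I hpdI r q hp π
  -- `h` factors through the image
  have hker : LinearMap.ker g.rangeRestrict ≤ LinearMap.ker h.hom := by
    intro x hx
    rw [LinearMap.ker_rangeRestrict] at hx
    have : h.hom x = 0 := by
      funext j
      exact hg (LinearMap.proj j ∘ₗ h.hom) hx
    exact this
  have hker' : kernel.ι π ≫ h = 0 := by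
    ext x
    have h1 : π (kernel.ι π x) = 0 := by
      rw [← ModuleCat.comp_apply, kernel.condition]; rfl
    exact congrFun (hker h1) _
  let s : I ⟶ ModuleCat.of A (Fin r → A) := (ShortComplex.exact_kernel π).desc h hker'
  have hs : π ≫ s = h := (ShortComplex.exact_kernel π).g_desc h hker'
  have hsq : s ≫ q = 𝟙 I := by
    rw [← cancel_epi π, ← Category.assoc, hs, hh, Category.comp_id]
  have hIp : Projective I := by
    have := free_proj (A := A) r
    exact (Retract.mk s q hsq).projective
  have hI : IsZero I := by
    refine hproj I ⟨kernel π, ?_⟩ hIp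
    have hX : (ShortComplex.mk (kernel.ι π) π (by simp)).ShortExact :=
      { exact := ShortComplex.exact_kernel π }
    let spl := hX.splittingOfProjective
    exact ⟨spl.isoBinaryBiproduct ≪≫ biprod.braiding _ _⟩
  intro f
  ext x
  have hx : g x = 0 := by
    have : π x = 0 := by
      rw [hI.eq_of_tgt π 0]; rfl
    exact congrArg Subtype.val this
  exact hg f.hom hx
end
end

section
/- Let Λ be a finite dimensional algebra with gl.dim Λ ≤ n and let 0 → X_0 → X_1 → ⋯ → X_n → X_{n+1} → 0 be an exact sequence in mod Λ with every X_i in add X for a fixed module X. If W ∈ mod Λ satisfies Ext^i_Λ(W, X)=0 for all 0<i<n, then applying Hom_Λ(W,−) and Ext^n_Λ(W,−) yields a single exact sequence: 0 → Hom(W,X_0) → ⋯ → Hom(W,X_{n+1}) → Ext^n(W,X_0) → ⋯ → Ext^n(W,X_{n+1}) → 0. -/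
noncomputable section

open CategoryTheory ModuleCat Limits Opposite

universe u

variable (k : Type u) [Field k] (A : Type u) [Ring A] [Algebra k A]

theorem abs_les {k A : Type u} [Field k] [Ring A]
    (T : ℕ → (ModuleCat.{u} A ⥤ ModuleCat.{u} k))
    (hinj : ∀ S : ShortComplex (ModuleCat.{u} A), S.ShortExact → Function.Injective ((T 0).map S.f))
    (hmid : ∀ S : ShortComplex (ModuleCat.{u} A), S.ShortExact → ∀ q,
      Function.Exact ((T q).map S.f) ((T q).map S.g))
    (hδ : ∀ S : ShortComplex (ModuleCat.{u} A), S.ShortExact → ∀ q,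
      ∃ δ : (T q).obj S.X₃ →ₗ[k] (T (q+1)).obj S.X₁,
        Function.Exact ((T q).map S.g) δ ∧ Function.Exact δ ((T (q+1)).map S.f))
    (n : ℕ) (hn : 1 ≤ n)
    (htop : ∀ Y, Subsingleton ((T (n+1)).obj Y))
    (X K : ℕ → ModuleCat.{u} A) (p : ∀ i, X i ⟶ K i) (ι : ∀ i, K i ⟶ X (i+1))
    (hp0 : IsIso (p 0)) (hιn : IsIso (ι n))
    (hz : ∀ i, i + 1 ≤ n → ι i ≫ p (i+1) = 0)
    (hS : ∀ i (hi : i + 1 ≤ n), (ShortComplex.mk (ι i) (p (i+1)) (hz i hi)).ShortExact)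
    (hX : ∀ i, i ≤ n + 1 → ∀ q, 0 < q → q < n → Subsingleton ((T q).obj (X i))) :
    ∃ δ : (T 0).obj (X (n + 1)) →ₗ[k] (T n).obj (X 0),
      Function.Injective ⇑((T 0).map (p 0 ≫ ι 0)) ∧
      (∀ i : ℕ, i + 1 ≤ n →
        Function.Exact ⇑((T 0).map (p i ≫ ι i))
          ⇑((T 0).map (p (i+1) ≫ ι (i + 1)))) ∧
      Function.Exact ⇑((T 0).map (p n ≫ ι n)) ⇑δ ∧
      Function.Exact ⇑δ ⇑((T n).map (p 0 ≫ ι 0)) ∧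
      (∀ i : ℕ, i + 1 ≤ n →
        Function.Exact ⇑((T n).map (p i ≫ ι i))
          ⇑((T n).map (p (i+1) ≫ ι (i + 1)))) ∧
      Function.Surjective ⇑((T n).map (p n ≫ ι n)) := by
  have bij : ∀ q {U V : ModuleCat.{u} A} (f : U ⟶ V), IsIso f → Function.Bijective ((T q).map f) := by
    intro q U V f hf
    exact ConcreteCategory.bijective_of_isIso ((T q).map f)
  -- vanishing below the diagonal
  have van1 : ∀ i m, 0 < m → m + i < n → Subsingleton ((T m).obj (K i)) := by
    intro i
    induction i with
    | zero =>
      intro m hm hmi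
      have := hX 0 (by omega) m hm (by omega)
      exact (bij m (p 0) hp0).2.subsingleton
    | succ i ih =>
      intro m hm hmi
      have h1 := hX (i+1) (by omega) m hm (by omega)
      have h2 := ih (m+1) (by omega) (by omega)
      obtain ⟨δ, e1, e2⟩ := hδ _ (hS i (by omega)) m
      refine subsingleton_of_forall_eq 0 fun y => ?_
      obtain ⟨x, rfl⟩ := (e1 y).1 (h2.elim _ _)
      rw [h1.elim x 0, map_zero]
  have van2 : ∀ j i m, i + j = n → m < n → n + 1 ≤ m + i → Subsingleton ((T m).obj (K i)) := by
    intro j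
    induction j with
    | zero =>
      intro i m hi hm hmi
      obtain rfl : i = n := by omega
      have := hX (i+1) (by omega) m (by omega) (by omega)
      exact (bij m (ι i) hιn).1.subsingleton
    | succ j ih =>
      intro i m hi hm hmi
      obtain ⟨m, rfl⟩ : ∃ m', m = m' + 1 := ⟨m - 1, by omega⟩
      have h1 := hX (i+1) (by omega) (m+1) (by omega) (by omega)
      have h2 := ih (i+1) m (by omega) (by omega) (by omega)
      obtain ⟨δ, e1, e2⟩ := hδ _ (hS i (by omega)) m
      refine subsingleton_of_forall_eq 0 fun y => ?_
      obtain ⟨x, rfl⟩ := (e2 y).1 (h1.elim _ _)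
      rw [h2.elim x 0, map_zero]
  have exc : ∀ q i, i + 1 ≤ n → Function.Surjective ((T q).map (p i)) →
      Function.Injective ((T q).map (ι (i+1))) →
      Function.Exact ⇑((T q).map (p i ≫ ι i)) ⇑((T q).map (p (i+1) ≫ ι (i + 1))) := by
    intro q i hi hs hj y
    have := hmid _ (hS i hi) q y
    simp only [Functor.map_comp, ModuleCat.comp_apply, Set.mem_range] at *
    rw [← map_zero ((T q).map (ι (i+1))).hom]
    refine (hj.eq_iff).trans (this.trans ⟨?_, ?_⟩)
    · rintro ⟨x, rfl⟩
      obtain ⟨z, rfl⟩ := hs x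
      exact ⟨z, rfl⟩
    · rintro ⟨x, rfl⟩
      exact ⟨_, rfl⟩
  have inj0 : ∀ i, i ≤ n → Function.Injective ((T 0).map (ι i)) := by
    intro i hi
    rcases hi.eq_or_lt with rfl | hi
    · exact (bij 0 _ hιn).1
    · exact hinj _ (hS i hi)
  have surn : ∀ i, i ≤ n → Function.Surjective ((T n).map (p i)) := by
    intro i hi
    rcases i with _ | i
    · exact (bij n _ hp0).2
    · obtain ⟨δ, e1, e2⟩ := hδ _ (hS i (by omega)) n
      intro y
      exact (e1 y).1 ((htop _).elim _ _)
  have key : ∀ j, 1 ≤ j → j ≤ n → ∀ i, i + j = n →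
      ∃ φ : (T 0).obj (K n) →ₗ[k] (T j).obj (K i),
        Function.Exact ((T 0).map (p n)) φ ∧ Function.Exact φ ((T j).map (ι i)) := by
    intro j hj
    induction j, hj using Nat.le_induction with
    | base =>
      intro _ i hi
      subst hi
      exact hδ _ (hS i (by omega)) 0
    | succ j hj ih =>
      intro hjn i hi
      obtain ⟨φ, f1, f2⟩ := ih (by omega) (i+1) (by omega)
      obtain ⟨δ, e1, e2⟩ := hδ _ (hS i (by omega)) j
      have z1 := hX (i+1) (by omega) j (by omega) (by omega)
      have z2 := hX (i+1+1) (by omega) j (by omega) (by omega)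
      have dinj : Function.Injective δ := by
        rw [injective_iff_map_eq_zero]
        intro y hy
        obtain ⟨x, rfl⟩ := (e1 y).1 hy
        rw [z1.elim x 0, map_zero]
      have fsur : Function.Surjective φ := fun y => (f2 y).1 (z2.elim _ _)
      refine ⟨δ ∘ₗ φ, fun y => ?_, fun y => ?_⟩
      · rw [← f1 y, LinearMap.comp_apply, ← map_zero δ, dinj.eq_iff]
      · rw [e2 y]
        constructor
        · rintro ⟨x, rfl⟩
          obtain ⟨z, rfl⟩ := fsur x
          exact ⟨z, rfl⟩
        · rintro ⟨x, rfl⟩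
          exact ⟨_, rfl⟩
  obtain ⟨φ, f1, f2⟩ := key n hn le_rfl 0 (by omega)
  let e0 : (T 0).obj (K n) ≃ₗ[k] (T 0).obj (X (n+1)) :=
    LinearEquiv.ofBijective ((T 0).map (ι n)).hom (bij 0 _ hιn)
  let en : (T n).obj (X 0) ≃ₗ[k] (T n).obj (K 0) :=
    LinearEquiv.ofBijective ((T n).map (p 0)).hom (bij n _ hp0)
  refine ⟨en.symm.toLinearMap ∘ₗ φ ∘ₗ e0.symm.toLinearMap, ?_, ?_, ?_, ?_, ?_, ?_⟩
  · rw [Functor.map_comp]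
    exact (inj0 0 (by omega)).comp (bij 0 _ hp0).1
  · intro i hi
    refine exc 0 i hi ?_ (inj0 _ (by omega))
    rcases i with _ | i
    · exact (bij 0 _ hp0).2
    · obtain ⟨δ, e1, e2⟩ := hδ _ (hS i (by omega)) 0
      intro y
      exact (e1 y).1 ((van1 i (0+1) (by omega) (by omega)).elim _ _)
  · intro y
    obtain ⟨y, rfl⟩ := e0.surjective y
    have := f1 y
    simp only [LinearMap.comp_apply, LinearEquiv.coe_coe, LinearEquiv.symm_apply_apply,
      LinearEquiv.map_eq_zero_iff]
    rw [this]
    simp only [Functor.map_comp, ModuleCat.comp_apply, Set.mem_range]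
    exact exists_congr fun x => (e0.injective.eq_iff (a := ((T 0).map (p n)) x) (b := y)).symm
  · intro y
    have := f2 (en y)
    rw [Functor.map_comp, ModuleCat.comp_apply]
    refine this.trans ?_
    simp only [Set.mem_range, LinearMap.comp_apply, LinearEquiv.coe_coe]
    constructor
    · rintro ⟨x, hx⟩
      exact ⟨e0 x, by simp [hx]⟩
    · rintro ⟨x, rfl⟩
      exact ⟨e0.symm x, by simp⟩
  · intro i hi
    refine exc n i hi (surn i (by omega)) ?_
    rcases hi.eq_or_lt with rfl | hi
    · exact (bij _ _ hιn).1
    · obtain ⟨m, rfl⟩ : ∃ m, n = m + 1 := ⟨n - 1, by omega⟩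
      obtain ⟨δ, e1, e2⟩ := hδ _ (hS (i+1) (by omega)) m
      have := van2 (m+1 - (i+1+1)) (i+1+1) m (by omega) (by omega) (by omega)
      refine (injective_iff_map_eq_zero ((T (m+1)).map (ι (i+1))).hom).2 fun y hy => ?_
      obtain ⟨x, rfl⟩ := (e2 y).1 hy
      rw [this.elim x 0, map_zero]
  · rw [Functor.map_comp]
    exact (bij n _ hιn).2.comp (surn n le_rfl)

abbrev hF (Y : ModuleCat.{u} A) : ModuleCat.{u} A ⥤ (ModuleCat.{u} k)ᵒᵖ :=
  ((linearYoneda k (ModuleCat.{u} A)).obj Y).rightOp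

abbrev hFm {Y Y' : ModuleCat.{u} A} (f : Y ⟶ Y') : hF k A Y' ⟶ hF k A Y :=
  NatTrans.rightOp ((linearYoneda k (ModuleCat.{u} A)).map f)

section
variable (P : ChainComplex (ModuleCat.{u} A) ℕ)

def hC (Y : ModuleCat.{u} A) : ChainComplex (ModuleCat.{u} k)ᵒᵖ ℕ :=
  ((hF k A Y).mapHomologicalComplex _).obj P

def hCm {Y Y' : ModuleCat.{u} A} (f : Y ⟶ Y') : hC k A P Y' ⟶ hC k A P Y :=
  (NatTrans.mapHomologicalComplex (hFm k A f) _).app P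

theorem hCm_add {Y Y' : ModuleCat.{u} A} (f g : Y ⟶ Y') :
    hCm k A P (f + g) = hCm k A P f + hCm k A P g := by
  ext i
  apply Quiver.Hom.unop_inj
  ext (x : P.X i ⟶ Y)
  exact Preadditive.comp_add _ _ _ x f g

theorem hCm_zero {Y Y' : ModuleCat.{u} A} :
    hCm k A P (0 : Y ⟶ Y') = 0 := by
  ext i
  apply Quiver.Hom.unop_inj
  ext (x : P.X i ⟶ Y)
  exact comp_zero (C := ModuleCat.{u} A) (f := x)

theorem hCm_comp {Y Y' Y'' : ModuleCat.{u} A} (f : Y ⟶ Y') (g : Y' ⟶ Y'') :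
    hCm k A P (f ≫ g) = hCm k A P g ≫ hCm k A P f := by
  ext i
  apply Quiver.Hom.unop_inj
  ext (x : P.X i ⟶ Y)
  exact (Category.assoc x f g).symm

def hS (S : ShortComplex (ModuleCat.{u} A)) : ShortComplex (ChainComplex (ModuleCat.{u} k)ᵒᵖ ℕ) :=
  ShortComplex.mk (hCm k A P S.g) (hCm k A P S.f) (by rw [← hCm_comp, S.zero, hCm_zero])

theorem hS_exact [∀ i, Projective (P.X i)] (S : ShortComplex (ModuleCat.{u} A)) (h : S.ShortExact) :
    (hS k A P S).ShortExact := by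
  have := h.mono_f
  have := h.epi_g
  apply HomologicalComplex.shortExact_of_degreewise_shortExact
  intro i
  let S' : ShortComplex (ModuleCat.{u} k) :=
    ((hS k A P S).map (HomologicalComplex.eval _ _ i)).unop
  have hS' : S'.ShortExact := by
    have h1 : Function.Injective (fun x : P.X i ⟶ S.X₁ => x ≫ S.f) :=
      fun a b hab => (cancel_mono S.f).1 hab
    have h2 : Function.Surjective (fun x : P.X i ⟶ S.X₂ => x ≫ S.g) :=
      fun a => ⟨Projective.factorThru a S.g, Projective.factorThru_comp _ _⟩
    have h3 : Function.Exact (fun x : P.X i ⟶ S.X₁ => x ≫ S.f)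
        (fun x : P.X i ⟶ S.X₂ => x ≫ S.g) := by
      intro y
      constructor
      · intro hy
        exact ⟨h.exact.lift y hy, h.exact.lift_f y hy⟩
      · rintro ⟨x, rfl⟩
        simp
    exact
      { exact := (ShortComplex.ShortExact.moduleCat_exact_iff_function_exact S').2 h3
        mono_f := (ModuleCat.mono_iff_injective S'.f).2 h1
        epi_g := (ModuleCat.epi_iff_surjective S'.g).2 h2 }
  exact hS'.op

end

def extIso (W Y : ModuleCat.{u} A) (q : ℕ) :
    ((Ext k (ModuleCat.{u} A) q).obj (op W)).obj Y ≅
      ((hC k A (projectiveResolution W).complex Y).homology q).unop :=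
  ((projectiveResolution W).isoLeftDerivedObj (hF k A Y) q).symm.unop

theorem extIso_nat (W : ModuleCat.{u} A) {Y Y' : ModuleCat.{u} A} (f : Y ⟶ Y') (q : ℕ) :
    ((Ext k (ModuleCat.{u} A) q).obj (op W)).map f ≫ (extIso k A W Y' q).hom =
      (extIso k A W Y q).hom ≫
        (HomologicalComplex.homologyMap (hCm k A (projectiveResolution W).complex f) q).unop := by
  have h := (projectiveResolution W).leftDerived_app_eq (hFm k A f) q
  have h' : (NatTrans.leftDerived (hFm k A f) q).app W =
    (((Ext k (ModuleCat.{u} A) q).obj (op W)).map f).op := rfl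
  apply Quiver.Hom.op_inj
  rw [op_comp, ← h', h]
  exact Iso.inv_hom_id_assoc ((projectiveResolution W).isoLeftDerivedObj (hF k A Y') q) _

theorem ext_map_eq (W : ModuleCat.{u} A) {Y Y' : ModuleCat.{u} A} (f : Y ⟶ Y') (q : ℕ) :
    ((Ext k (ModuleCat.{u} A) q).obj (op W)).map f =
      (extIso k A W Y q).hom ≫
        (HomologicalComplex.homologyMap (hCm k A (projectiveResolution W).complex f) q).unop ≫
          (extIso k A W Y' q).inv := by
  rw [← Category.assoc, ← extIso_nat, Category.assoc, Iso.hom_inv_id, Category.comp_id]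

instance ext_additive (W : ModuleCat.{u} A) (q : ℕ) :
    ((Ext k (ModuleCat.{u} A) q).obj (op W)).Additive where
  map_add {Y Y' f g} := by
    rw [ext_map_eq, ext_map_eq, ext_map_eq, hCm_add, HomologicalComplex.homologyMap_add, unop_add]
    simp only [Preadditive.comp_add, Preadditive.add_comp]

theorem ext_inj (W : ModuleCat.{u} A) (S : ShortComplex (ModuleCat.{u} A)) (h : S.ShortExact) :
    Function.Injective (((Ext k (ModuleCat.{u} A) 0).obj (op W)).map S.f) := by
  rw [← ModuleCat.mono_iff_injective, ext_map_eq]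
  have hs := hS_exact k A (projectiveResolution W).complex S h
  have : Epi (hCm k A (projectiveResolution W).complex S.f) := hs.epi_g
  have : Epi (HomologicalComplex.homologyMap (hCm k A (projectiveResolution W).complex S.f) 0) := by
    apply HomologicalComplex.epi_homologyMap_of_epi_of_not_rel
    intro j
    simp
  infer_instance

/-- transporting exactness along isomorphisms -/
theorem ex_transport {M₁ M₂ M₃ N₁ N₂ N₃ : ModuleCat.{u} k} (e₁ : M₁ ≅ N₁) (e₂ : M₂ ≅ N₂)
    (e₃ : M₃ ≅ N₃) (f : N₁ ⟶ N₂) (g : N₂ ⟶ N₃) (hfg : Function.Exact f g) :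
    Function.Exact (e₁.hom ≫ f ≫ e₂.inv) (e₂.hom ≫ g ≫ e₃.inv) := by
  have w : f ≫ g = 0 := by
    ext x
    exact hfg.apply_apply_eq_zero x
  have h := (ShortComplex.ShortExact.moduleCat_exact_iff_function_exact (ShortComplex.mk f g w)).2 hfg
  have w' : (e₁.hom ≫ f ≫ e₂.inv) ≫ (e₂.hom ≫ g ≫ e₃.inv) = 0 := by
    simp [reassoc_of% w]
  refine (ShortComplex.ShortExact.moduleCat_exact_iff_function_exact (ShortComplex.mk _ _ w')).1 ?_
  exact ShortComplex.exact_of_iso (ShortComplex.isoMk e₁.symm e₂.symm e₃.symm) h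

theorem unop_ex {M₁ M₂ M₃ : (ModuleCat.{u} k)ᵒᵖ} (f : M₁ ⟶ M₂) (g : M₂ ⟶ M₃) (w : f ≫ g = 0)
    (h : (ShortComplex.mk f g w).Exact) : Function.Exact g.unop f.unop :=
  (ShortComplex.ShortExact.moduleCat_exact_iff_function_exact _).1 h.unop

theorem ext_mid (W : ModuleCat.{u} A) (S : ShortComplex (ModuleCat.{u} A)) (h : S.ShortExact)
    (q : ℕ) :
    Function.Exact (((Ext k (ModuleCat.{u} A) q).obj (op W)).map S.f)
      (((Ext k (ModuleCat.{u} A) q).obj (op W)).map S.g) := by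
  rw [ext_map_eq, ext_map_eq]
  exact ex_transport _ _ _ _ _ _
    (unop_ex _ _ _ _ ((hS_exact k A (projectiveResolution W).complex S h).homology_exact₂ q))

theorem ext_conn (W : ModuleCat.{u} A) (S : ShortComplex (ModuleCat.{u} A)) (h : S.ShortExact)
    (q : ℕ) :
    ∃ δ : ((Ext k (ModuleCat.{u} A) q).obj (op W)).obj S.X₃ →ₗ[k]
        ((Ext k (ModuleCat.{u} A) (q+1)).obj (op W)).obj S.X₁,
      Function.Exact (((Ext k (ModuleCat.{u} A) q).obj (op W)).map S.g) δ ∧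
      Function.Exact δ (((Ext k (ModuleCat.{u} A) (q+1)).obj (op W)).map S.f) := by
  have hs := hS_exact k A (projectiveResolution W).complex S h
  let δ' := hs.δ (q+1) q (by simp)
  refine ⟨((extIso k A W S.X₃ q).hom ≫ δ'.unop ≫ (extIso k A W S.X₁ (q+1)).inv).hom, ?_, ?_⟩
  · rw [ext_map_eq]
    exact ex_transport _ _ _ _ _ _ (unop_ex _ _ _ _ (hs.homology_exact₁ (q+1) q (by simp)))
  · rw [ext_map_eq]
    exact ex_transport _ _ _ _ _ _ (unop_ex _ _ _ _ (hs.homology_exact₃ (q+1) q (by simp)))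

theorem add_van (W Z X : ModuleCat.{u} A) (q : ℕ) (hX : InAdd A {Z} X) (h : extZero k A q W Z) :
    Subsingleton (((Ext k (ModuleCat.{u} A) q).obj (op W)).obj X) := by
  obtain ⟨Y, m, f, hf, ⟨e⟩⟩ := hX
  apply ModuleCat.subsingleton_of_isZero
  rw [IsZero.iff_id_eq_zero, ← CategoryTheory.Functor.map_id]
  have h1 : 𝟙 X = biprod.inl ≫ e.hom ≫ (∑ j, biproduct.π f j ≫ biproduct.ι f j) ≫ e.inv ≫
      biprod.fst := by
    rw [biproduct.total]
    simp
  rw [h1]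
  simp only [Preadditive.sum_comp, Preadditive.comp_sum, Functor.map_sum]
  refine Finset.sum_eq_zero fun j _ => ?_
  have hz : IsZero (((Ext k (ModuleCat.{u} A) q).obj (op W)).obj (f j)) := by
    have : f j = Z := hf j
    rw [this]
    have : Subsingleton (((Ext k (ModuleCat.{u} A) q).obj (op W)).obj Z) := h
    exact ModuleCat.isZero_of_subsingleton _
  simp only [Functor.map_comp, Category.assoc]
  rw [hz.eq_of_tgt (((Ext k (ModuleCat.{u} A) q).obj (op W)).map (biproduct.π f j)) 0]
  simp

/-- Given `gl.dim A ≤ n`, an exact sequence `0 → X₀ → ⋯ → X_{n+1} → 0` with all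
terms in `add Z`, and `W` with `Ext^i_A(W, Z) = 0` for `0 < i < n`, applying
`Hom_A(W,-)` and `Ext^n_A(W,-)` yields a single long exact sequence. -/
theorem hom_ext_long_exact_sequence
    [FiniteDimensional k A] (n : ℕ) (hn : 1 ≤ n) (hgl : gldimLE k A n)
    (Z : ModuleCat.{u} A) (hZ : Module.Finite A Z)
    (X : ℕ → ModuleCat.{u} A) (d : ∀ i : ℕ, X i ⟶ X (i + 1))
    (hadd : ∀ i : ℕ, i ≤ n + 1 → InAdd A {Z} (X i))
    (hmono : Function.Injective ⇑(d 0))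
    (hepi : Function.Surjective ⇑(d n))
    (hexact : ∀ i : ℕ, i + 1 ≤ n → Function.Exact ⇑(d i) ⇑(d (i + 1)))
    (W : ModuleCat.{u} A) (hW : Module.Finite A W)
    (hvan : ∀ i : ℕ, 0 < i → i < n → extZero k A i W Z) :
    ∃ δ : extGrp k A 0 W (X (n + 1)) →ₗ[k] extGrp k A n W (X 0),
      Function.Injective ⇑(((Ext k (ModuleCat.{u} A) 0).obj (op W)).map (d 0)) ∧
      (∀ i : ℕ, i + 1 ≤ n →
        Function.Exact ⇑(((Ext k (ModuleCat.{u} A) 0).obj (op W)).map (d i))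
          ⇑(((Ext k (ModuleCat.{u} A) 0).obj (op W)).map (d (i + 1)))) ∧
      Function.Exact ⇑(((Ext k (ModuleCat.{u} A) 0).obj (op W)).map (d n)) ⇑δ ∧
      Function.Exact ⇑δ ⇑(((Ext k (ModuleCat.{u} A) n).obj (op W)).map (d 0)) ∧
      (∀ i : ℕ, i + 1 ≤ n →
        Function.Exact ⇑(((Ext k (ModuleCat.{u} A) n).obj (op W)).map (d i))
          ⇑(((Ext k (ModuleCat.{u} A) n).obj (op W)).map (d (i + 1)))) ∧
      Function.Surjective ⇑(((Ext k (ModuleCat.{u} A) n).obj (op W)).map (d n)) := by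
  let K : ℕ → ModuleCat.{u} A := fun i => ModuleCat.of A (LinearMap.range (d i).hom)
  let p : ∀ i, X i ⟶ K i := fun i => ModuleCat.ofHom (d i).hom.rangeRestrict
  let ι : ∀ i, K i ⟶ X (i+1) := fun i => ModuleCat.ofHom (LinearMap.range (d i).hom).subtype
  have hd : ∀ i, d i = p i ≫ ι i := fun i => rfl
  have hp : ∀ i, Function.Surjective (p i) := fun i => (d i).hom.surjective_rangeRestrict
  have hι : ∀ i, Function.Injective (ι i) := fun i => Subtype.val_injective
  have hp0 : IsIso (p 0) := by
    rw [ConcreteCategory.isIso_iff_bijective]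
    refine ⟨?_, hp 0⟩
    have : Function.Injective (ι 0 ∘ p 0) := hmono
    exact this.of_comp
  have hιn : IsIso (ι n) := by
    rw [ConcreteCategory.isIso_iff_bijective]
    refine ⟨hι n, ?_⟩
    have : Function.Surjective (ι n ∘ p n) := hepi
    exact this.of_comp
  have hex : ∀ i, i + 1 ≤ n → Function.Exact (ι i) (p (i+1)) := by
    intro i hi y
    have h := hexact i hi y
    constructor
    · intro hy
      obtain ⟨x, hx⟩ := h.1 (congrArg (ι (i+1)) hy)
      exact ⟨p i x, hx⟩
    · rintro ⟨x, rfl⟩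
      obtain ⟨z, rfl⟩ := hp i x
      exact hι (i+1) (h.2 ⟨z, rfl⟩)
  have hz : ∀ i, i + 1 ≤ n → ι i ≫ p (i+1) = 0 := by
    intro i hi
    ext x
    exact congrArg _ ((hex i hi).apply_apply_eq_zero x)
  have hS : ∀ i (hi : i + 1 ≤ n), (ShortComplex.mk (ι i) (p (i+1)) (hz i hi)).ShortExact := by
    intro i hi
    exact
      { exact := (ShortComplex.ShortExact.moduleCat_exact_iff_function_exact _).2 (hex i hi)
        mono_f := (ModuleCat.mono_iff_injective _).2 (hι i)
        epi_g := (ModuleCat.epi_iff_surjective _).2 (hp (i+1)) }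
  exact abs_les (fun q => (Ext k (ModuleCat.{u} A) q).obj (op W))
    (fun S h => ext_inj k A W S h) (fun S h q => ext_mid k A W S h q)
    (fun S h q => ext_conn k A W S h q) n hn (fun Y => hgl (n+1) (by omega) W Y)
    X K p ι hp0 hιn hz hS
    (fun i hi q h0 hq => add_van k A W Z (X i) q (hadd i hi) (hvan q h0 hq))
end
end

section
/- Let Λ be a finite dimensional algebra with gl.dim Λ ≤ n and let X be a bounded complex in K^b(proj Λ) with H^i(X)=0 for all 0 < i < n. Then X decomposes as X ≅ Y ⊕ Z in the derived category, with Y concentrated in cohomological degrees ≤ 0 and Z in degrees ≥ n. -/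
noncomputable section

open CategoryTheory ModuleCat Limits Opposite

universe u

variable (k : Type u) [Field k] (A : Type u) [Ring A] [Algebra k A]
variable [HasDerivedCategory (ModuleCat.{u} A)]

/-- `X` is a retract (direct summand) of `W`. -/
def RetractOf {C : Type*} [Category C] (X W : C) : Prop :=
  ∃ (s : X ⟶ W) (p : W ⟶ X), s ≫ p = 𝟙 X

/-- `X` is a direct sum of the finite family `f`. -/
def IsDirectSumOf {C : Type*} [Category C] [Preadditive C] {ι : Type*} [Fintype ι]
    (X : C) (f : ι → C) : Prop :=
  ∃ (p : ∀ i, X ⟶ f i) (s : ∀ i, f i ⟶ X),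
    (∀ i, s i ≫ p i = 𝟙 (f i)) ∧ (∀ i j, i ≠ j → s i ≫ p j = 0) ∧
    (∑ i, p i ≫ s i) = 𝟙 X

/-- `X` is a direct sum of two objects `Y` and `Z`. -/
def IsBiprodOf {C : Type*} [Category C] [Preadditive C] (X Y Z : C) : Prop :=
  ∃ (p : X ⟶ Y) (q : X ⟶ Z) (s : Y ⟶ X) (t : Z ⟶ X),
    s ≫ p = 𝟙 Y ∧ t ≫ q = 𝟙 Z ∧ s ≫ q = 0 ∧ t ≫ p = 0 ∧
    p ≫ s + q ≫ t = 𝟙 X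

/-- `X` lies in the additive closure of the class `S`: it is a retract of a
finite direct sum of objects of `S`. -/
def InAddC {C : Type*} [Category C] [Preadditive C] (S : Set C) (X : C) : Prop :=
  ∃ (m : ℕ) (f : Fin m → C) (W : C),
    (∀ i, f i ∈ S) ∧ IsDirectSumOf W f ∧ RetractOf X W

/-- The `i`-th cohomology functor on the derived category. -/
def Hq (i : ℤ) : DerivedCategory (ModuleCat.{u} A) ⥤ ModuleCat.{u} A :=
  DerivedCategory.homologyFunctor _ i

/-- `X ∈ D^{≥ m}`. -/
def CohGE (m : ℤ) (X : DerivedCategory (ModuleCat.{u} A)) : Prop :=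
  ∀ i : ℤ, i < m → IsZero ((Hq A i).obj X)

/-- `X ∈ D^{≤ m}`. -/
def CohLE (m : ℤ) (X : DerivedCategory (ModuleCat.{u} A)) : Prop :=
  ∀ i : ℤ, m < i → IsZero ((Hq A i).obj X)

/-- `X` has bounded cohomology, i.e. `X ∈ D^b(mod A)`. -/
def Bdd (X : DerivedCategory (ModuleCat.{u} A)) : Prop :=
  ∃ a b : ℤ, ∀ i : ℤ, (i < a ∨ b < i) → IsZero ((Hq A i).obj X)

/-- `X` is a perfect complex: it is isomorphic in the derived category to a
bounded complex of projectives, i.e. `X ∈ K^b(proj A)`. -/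
def IsPerfD (X : DerivedCategory (ModuleCat.{u} A)) : Prop :=
  ∃ P : CochainComplex (ModuleCat.{u} A) ℤ,
    (∀ i : ℤ, Projective (P.X i)) ∧
    (∃ a b : ℤ, ∀ i : ℤ, (i < a ∨ b < i) → IsZero (P.X i)) ∧
    Nonempty (DerivedCategory.Q.obj P ≅ X)

/-- The inclusion `mod A → D(mod A)` as stalk complexes in degree `0`. -/
def singleD : ModuleCat.{u} A ⥤ DerivedCategory (ModuleCat.{u} A) :=
  DerivedCategory.singleFunctor _ 0

section Helpers

variable {C : Type*} [Category C] [Abelian C]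

lemma auxShortExact {X₁ X₂ X₃ : C} (f : X₁ ⟶ X₂) (g : X₂ ⟶ X₃) (w : f ≫ g = 0)
    (hS : (ShortComplex.mk f g w).Exact) :
    (ShortComplex.mk (cokernel.desc f g w) (cokernel.π g)
      (by rw [← cancel_epi (cokernel.π f)]; simp)).ShortExact := by
  have hm : Mono (cokernel.desc f g w) := hS.mono_cokernelDesc
  refine { exact := ?_, mono_f := hm, epi_g := by dsimp; infer_instance }
  apply ShortComplex.exact_of_g_is_cokernel
  refine CokernelCofork.IsColimit.ofπ' _ _ (fun {A} k hk => ?_)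
  have h : g ≫ k = 0 := by
    have := cokernel.π f ≫= hk
    simpa using this
  exact ⟨cokernel.desc g k h, cokernel.π_desc g k h⟩

lemma auxImageShortExact {X₁ X₂ : C} (f : X₁ ⟶ X₂) :
    (ShortComplex.mk (Abelian.image.ι f) (cokernel.π f) (by simp)).ShortExact := by
  refine { exact := ?_, mono_f := by dsimp; infer_instance, epi_g := by dsimp; infer_instance }
  apply ShortComplex.exact_of_f_is_kernel
  exact kernelIsKernel _

end Helpers

section Mod
variable {A : Type u} [Ring A]

lemma auxUp (R : ChainComplex (ModuleCat.{u} A) ℕ) (hp : ∀ i, Projective (R.X i))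
    (hex : ∀ i, (R.ExactAt (i+1))) (j : ℕ) : ∀ r : ℕ,
    HasProjectiveDimensionLT (cokernel (R.d (j+1) j)) (r+1) →
    HasProjectiveDimensionLT (cokernel (R.d 1 0)) (r+j+1) := by
  induction j with
  | zero => intro r h; exact h
  | succ j ih =>
    intro r h
    have h2 : HasProjectiveDimensionLT (cokernel (R.d (j+1) j)) (r+1+1) := by
      have := hp j
      have e := hex j
      rw [R.exactAt_iff' (j+2) (j+1) j (by simp) (by simp)] at e
      have hs := auxShortExact _ _ _ e
      exact hs.hasProjectiveDimensionLT_X₃ (r+1) h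
        (hasProjectiveDimensionLT_of_ge (R.X j) 1 _ (by omega))
    have := ih _ h2
    convert this using 1
    omega

lemma auxDown (P : CochainComplex (ModuleCat.{u} A) ℤ) (hp : ∀ i, Projective (P.X i))
    (a : ℤ) (m : ℕ) : ∀ b c : ℤ, b = a + m → b + 1 = c →
    (∀ i, a < i → i ≤ b → P.ExactAt i) →
    HasProjectiveDimensionLT (cokernel (P.d b c)) (m+2) →
    HasProjectiveDimensionLT (cokernel (P.d a (a+1))) 2 := by
  induction m with
  | zero =>
    intro b c hb hc _ h
    obtain rfl : b = a := by simpa using hb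
    subst hc
    exact h
  | succ m ih =>
    intro b c hb hc hex h
    refine ih (b-1) b (by push_cast at hb; omega) (by omega)
      (fun i h1 h2 => hex i h1 (by omega)) ?_
    have := hp c
    have e := hex b (by push_cast at hb; omega) le_rfl
    rw [P.exactAt_iff' (b-1) b c (by simp) (by simp [hc])] at e
    have hs := auxShortExact _ _ _ e
    exact hs.hasProjectiveDimensionLT_X₁ (m+2)
        (hasProjectiveDimensionLT_of_ge (P.X c) 1 _ (by omega)) h

lemma auxGl {k : Type u} [Field k] [Algebra k A] (n : ℕ) (hgl : gldimLE k A n)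
    (X : ModuleCat.{u} A) : HasProjectiveDimensionLT X (n+1) := by
  let R := ProjectiveResolution.of X
  have key : ∀ (Y : ModuleCat.{u} A) (x : R.complex.X (n+1) ⟶ Y),
      R.complex.d (n+2) (n+1) ≫ x = 0 → ∃ y : R.complex.X n ⟶ Y,
        R.complex.d (n+1) n ≫ y = x := by
    intro Y x hx
    have h1 : Subsingleton (extGrp k A (n+1) X Y) := hgl (n+1) (by omega) X Y
    have h2 : IsZero ((R.complex.linearYonedaObj k Y).homology (n+1)) :=
      (ModuleCat.isZero_of_subsingleton (extGrp k A (n+1) X Y)).of_iso (R.isoExt (n+1) Y).symm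
    rw [← HomologicalComplex.exactAt_iff_isZero_homology,
      HomologicalComplex.exactAt_iff' _ n (n+1) (n+2) (by simp) (by simp),
      ShortComplex.moduleCat_exact_iff] at h2
    obtain ⟨y, hy⟩ := h2 x hx
    exact ⟨y, hy⟩
  have hproj : Projective (cokernel (R.complex.d (n+1) n)) := by
    obtain ⟨y, hy⟩ := key _ (Abelian.factorThruImage (R.complex.d (n+1) n)) (by
      rw [← cancel_mono (Abelian.image.ι (R.complex.d (n+1) n))]; simp)
    have hs := auxImageShortExact (R.complex.d (n+1) n)
    have hr : Abelian.image.ι (R.complex.d (n+1) n) ≫ y = 𝟙 _ := by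
      rw [← cancel_epi (Abelian.factorThruImage (R.complex.d (n+1) n))]
      simpa using hy
    have := hs.mono_f
    have := hs.epi_g
    let sp := ShortComplex.Splitting.ofExactOfRetraction _ hs.exact y hr hs.epi_g
    exact (Retract.mk sp.s (cokernel.π (R.complex.d (n+1) n)) sp.s_g).projective
  have h3 := auxUp R.complex (fun i => R.projective i) (fun i => R.complex_exactAt_succ i) n 0
    inferInstance
  have e : cokernel (R.complex.d 1 0) ≅ X :=
    (cokernelIsCokernel (R.complex.d 1 0)).coconePointUniqueUpToIso R.isColimitCokernelCofork
  rw [Nat.zero_add] at h3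
  exact hasProjectiveDimensionLT_of_iso e (n+1)

lemma auxIdem (P : CochainComplex (ModuleCat.{u} A) ℤ)
    (f₀ : P.X 0 ⟶ P.X 0) (h1 : f₀ ≫ f₀ = f₀) (h2 : f₀ ≫ P.d 0 1 = 0)
    (h3 : ∀ (W : ModuleCat.{u} A) (x : W ⟶ P.X 0), x ≫ P.d 0 1 = 0 → x ≫ f₀ = x) :
    ∃ e : P ⟶ P, e ≫ e = e ∧ (∀ i, i < 0 → e.f i = 𝟙 _) ∧ (∀ i, 0 < i → e.f i = 0) ∧
      e.f 0 = f₀ := by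
  have : ∀ i : ℤ, ∃ f : P.X i ⟶ P.X i, (i < 0 → f = 𝟙 _) ∧ (0 < i → f = 0) ∧
      (f ≫ f = f) ∧ (∀ h : i = 0, f = eqToHom (by rw [h]) ≫ f₀ ≫ eqToHom (by rw [h])) := by
    intro i
    rcases lt_trichotomy i 0 with h | h | h
    · exact ⟨𝟙 _, by simp, by omega, by simp, by omega⟩
    · subst h
      exact ⟨f₀, by simp, by simp, h1, by simp⟩
    · exact ⟨0, by omega, by simp, by simp, by omega⟩
  choose f hneg hpos hid hz using this
  have hz0 : f 0 = f₀ := by simpa using hz 0 rfl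
  refine ⟨{ f := f, comm' := ?_ }, ?_, hneg, hpos, hz0⟩
  · intro i j hij
    obtain rfl : i + 1 = j := hij
    rcases lt_trichotomy i 0 with h | h | h
    · rw [hneg i h]
      by_cases h' : i = -1
      · subst h'
        have : P.d (-1) (-1+1) ≫ f (-1+1) = P.d (-1) (-1+1) := by
          change P.d (-1) 0 ≫ f 0 = P.d (-1) 0
          rw [hz0]
          exact h3 _ _ (by simp)
        rw [this]; simp
      · rw [hneg (i+1) (by omega)]; simp
    · subst h
      rw [hz0, hpos (0+1) (by omega)]
      simpa using h2
    · rw [hpos i h, hpos (i+1) (by omega)]; simp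
  · ext1 i
    exact hid i

end Mod

lemma auxHq (A : Type u) [Ring A] [HasDerivedCategory (ModuleCat.{u} A)] (i : ℤ)
    (K : CochainComplex (ModuleCat.{u} A) ℤ) :
    IsZero ((Hq A i).obj (DerivedCategory.Q.obj K)) ↔ K.ExactAt i := by
  rw [HomologicalComplex.exactAt_iff_isZero_homology]
  exact ((DerivedCategory.homologyFunctorFactors (ModuleCat.{u} A) i).app K).isZero_iff

lemma auxExactZero {A : Type u} [Ring A] (i : ℤ)
    (K : CochainComplex (ModuleCat.{u} A) ℤ) (h : IsZero (K.X i)) : K.ExactAt i := by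
  rw [HomologicalComplex.exactAt_iff]
  exact ShortComplex.exact_of_isZero_X₂ _ h

lemma auxExactRetract {A : Type u} [Ring A] (i : ℤ)
    {K L : CochainComplex (ModuleCat.{u} A) ℤ} (s : K ⟶ L) (p : L ⟶ K) (hsp : s ≫ p = 𝟙 K)
    (h : L.ExactAt i) : K.ExactAt i := by
  rw [HomologicalComplex.exactAt_iff_isZero_homology] at h ⊢
  rw [IsZero.iff_id_eq_zero, ← HomologicalComplex.homologyMap_id, ← hsp,
    HomologicalComplex.homologyMap_comp, h.eq_of_tgt (HomologicalComplex.homologyMap s i) 0,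
    zero_comp]

/-- If `gl.dim A ≤ n` and `X ∈ K^b(proj A)` has `H^i(X) = 0` for `0 < i < n`,
then `X ≅ Y ⊕ Z` in the derived category with `Y ∈ D^{≤0}` and `Z ∈ D^{≥n}`. -/
theorem splitting_of_vanishing_middle_cohomology
    [FiniteDimensional k A] (n : ℕ) (hn : 1 ≤ n) (hgl : gldimLE k A n)
    (P : CochainComplex (ModuleCat.{u} A) ℤ)
    (hproj : ∀ i : ℤ, Projective (P.X i))
    (hbdd : ∃ a b : ℤ, ∀ i : ℤ, (i < a ∨ b < i) → IsZero (P.X i))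
    (hH : ∀ i : ℤ, 0 < i → i < n → IsZero ((Hq A i).obj (DerivedCategory.Q.obj P))) :
    ∃ Y Z : DerivedCategory (ModuleCat.{u} A),
      IsPerfD A Y ∧ IsPerfD A Z ∧ CohLE A 0 Y ∧ CohGE A n Z ∧
      IsBiprodOf (DerivedCategory.Q.obj P) Y Z := by

  have hex : ∀ i : ℤ, 0 < i → i < n → P.ExactAt i := fun i h1 h2 => (auxHq A i P).1 (hH i h1 h2)
  obtain ⟨m, rfl⟩ : ∃ m, n = m + 1 := ⟨n - 1, by omega⟩
  have hpd : HasProjectiveDimensionLT (cokernel (P.d 0 (0+1))) 2 :=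
    auxDown P hproj 0 m m (m+1) (by simp) rfl
      (fun i h1 h2 => hex i h1 (by push_cast; omega)) (auxGl (m+1) hgl _)
  have hpB : Projective (Abelian.image (P.d 0 1)) := by
    have := hproj 1
    have hs := auxImageShortExact (P.d 0 1)
    have := hs.hasProjectiveDimensionLT_X₁ 1
      (inferInstanceAs (HasProjectiveDimensionLT (P.X 1) 1)) hpd
    exact projective_iff_hasProjectiveDimensionLT_one.2 this
  let π := Abelian.factorThruImage (P.d 0 1)
  let σ := Projective.factorThru (𝟙 _) π
  have hσ : σ ≫ π = 𝟙 _ := Projective.factorThru_comp _ _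
  have hπ : π ≫ Abelian.image.ι (P.d 0 1) = P.d 0 1 := Abelian.image.fac _
  have hf2 : (𝟙 _ - π ≫ σ) ≫ P.d 0 1 = 0 := by
    have h : (𝟙 _ - π ≫ σ) ≫ π ≫ Abelian.image.ι (P.d 0 1) = 0 := by
      rw [Preadditive.sub_comp, Category.assoc, reassoc_of% hσ]; simp
    rwa [hπ] at h
  have hf3 : ∀ (W : ModuleCat.{u} A) (x : W ⟶ P.X 0), x ≫ P.d 0 1 = 0 →
      x ≫ (𝟙 _ - π ≫ σ) = x := by
    intro W x hx
    have : x ≫ π = 0 := by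
      rw [← cancel_mono (Abelian.image.ι (P.d 0 1)), Category.assoc, hπ, hx, zero_comp]
    rw [Preadditive.comp_sub, reassoc_of% this]; simp
  obtain ⟨e, he, hneg, hpos, h0⟩ := auxIdem P (𝟙 _ - π ≫ σ) (hf3 _ _ hf2) hf2 hf3
  have he' : (𝟙 P - e) ≫ (𝟙 P - e) = 𝟙 P - e := Idempotents.idem_of_id_sub_idem e he
  obtain ⟨Y, s, p, hsp, hps⟩ := IsIdempotentComplete.idempotents_split P e he
  obtain ⟨Z, t, q, htq, hqt⟩ := IsIdempotentComplete.idempotents_split P (𝟙 P - e) he'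
  have hse : s ≫ e = s := by rw [← hps, reassoc_of% hsp]
  have hte : t ≫ e = 0 := by
    have : t ≫ (𝟙 P - e) = t := by rw [← hqt, reassoc_of% htq]
    rw [Preadditive.comp_sub, Category.comp_id] at this
    simpa using this
  have ret : ∀ (K : CochainComplex (ModuleCat.{u} A) ℤ) (s : K ⟶ P) (p : P ⟶ K),
      s ≫ p = 𝟙 K → IsPerfD A (DerivedCategory.Q.obj K) := by
    intro K s p hsp
    have hc : ∀ i, s.f i ≫ p.f i = 𝟙 _ := fun i => by
      rw [← HomologicalComplex.comp_f, hsp, HomologicalComplex.id_f]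
    refine ⟨K, fun i => ?_, ?_, ⟨Iso.refl _⟩⟩
    · have := hproj i
      exact (Retract.mk (s.f i) (p.f i) (hc i)).projective
    · obtain ⟨a, b, hab⟩ := hbdd
      refine ⟨a, b, fun i hi => ?_⟩
      rw [IsZero.iff_id_eq_zero, ← hc i, (hab i hi).eq_of_tgt (s.f i) 0, zero_comp]
  refine ⟨DerivedCategory.Q.obj Y, DerivedCategory.Q.obj Z, ret Y s p hsp, ret Z t q htq, ?_, ?_,
    DerivedCategory.Q.map p, DerivedCategory.Q.map q, DerivedCategory.Q.map s,
    DerivedCategory.Q.map t, ?_, ?_, ?_, ?_, ?_⟩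
  · intro i hi
    rw [auxHq]
    apply auxExactZero
    have h1 : s.f i ≫ p.f i = 𝟙 _ := by
      rw [← HomologicalComplex.comp_f, hsp, HomologicalComplex.id_f]
    have h2 : s.f i = 0 := by
      rw [← hse, HomologicalComplex.comp_f, hpos i hi, comp_zero]
    rw [IsZero.iff_id_eq_zero, ← h1, h2, zero_comp]
  · intro i hi
    rw [auxHq]
    have h1 : t.f i ≫ q.f i = 𝟙 _ := by
      rw [← HomologicalComplex.comp_f, htq, HomologicalComplex.id_f]
    have h2 : t.f i ≫ e.f i = 0 := by
      rw [← HomologicalComplex.comp_f, hte, HomologicalComplex.zero_f]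
    rcases lt_trichotomy i 0 with h | h | h
    · apply auxExactZero
      rw [hneg i h, Category.comp_id] at h2
      rw [IsZero.iff_id_eq_zero, ← h1, h2, zero_comp]
    · subst h
      have hm : Mono (Z.d 0 1) := by
        rw [Preadditive.mono_iff_cancel_zero]
        intro W x hx
        have h3 : (x ≫ t.f 0) ≫ P.d 0 1 = 0 := by
          rw [Category.assoc, t.comm, reassoc_of% hx, zero_comp]
        have h4 := hf3 _ _ h3
        rw [← h0, Category.assoc, h2, comp_zero] at h4
        rw [← Category.comp_id x, ← h1, ← Category.assoc, ← h4, zero_comp]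
      rw [Z.exactAt_iff' (-1) 0 1 (by simp) (by simp)]
      have hz : IsZero (Z.X (-1)) := by
        have h1 : t.f (-1) ≫ q.f (-1) = 𝟙 _ := by
          rw [← HomologicalComplex.comp_f, htq, HomologicalComplex.id_f]
        have h2 : t.f (-1) ≫ e.f (-1) = 0 := by
          rw [← HomologicalComplex.comp_f, hte, HomologicalComplex.zero_f]
        rw [hneg (-1) (by omega), Category.comp_id] at h2
        rw [IsZero.iff_id_eq_zero, ← h1, h2, zero_comp]
      rw [ShortComplex.exact_iff_mono _ (hz.eq_of_src _ _)]
      exact hm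
    · exact auxExactRetract i t q htq (hex i h hi)
  · rw [← Functor.map_comp, hsp, CategoryTheory.Functor.map_id]
  · rw [← Functor.map_comp, htq, CategoryTheory.Functor.map_id]
  · have : s ≫ q = 0 := by
      have h : s ≫ (q ≫ t) ≫ q = 0 := by
        rw [hqt, Preadditive.sub_comp, Preadditive.comp_sub, reassoc_of% hse]; simp
      simpa [htq] using h
    rw [← Functor.map_comp, this, Functor.map_zero]
  · have : t ≫ p = 0 := by
      have h : t ≫ (p ≫ s) ≫ p = 0 := by
        rw [hps, reassoc_of% hte, zero_comp]
      simpa [hsp] using h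
    rw [← Functor.map_comp, this, Functor.map_zero]
  · rw [← Functor.map_comp, ← Functor.map_comp, ← Functor.map_add, hps, hqt]
    simp
end
end

section
/- Let Λ be a finite dimensional algebra with gl.dim Λ ≤ n, and let X ∈ K^b(proj Λ) satisfy H^i(X)=0 for all integers i not divisible by n. Then X is isomorphic in the derived category to the direct sum over ℓ ∈ ℤ of its cohomologies H^{ℓn}(X)[−ℓn]. -/
noncomputable section

open CategoryTheory ModuleCat Limits Opposite

universe u

variable (k : Type u) [Field k] (A : Type u) [Ring A] [Algebra k A]
variable [HasDerivedCategory (ModuleCat.{u} A)]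

lemma isDirectSumOf_congr {C : Type*} [Category C] [Preadditive C] {ι : Type*} [Fintype ι]
    {X : C} {f g : ι → C} (h : IsDirectSumOf X f) (e : ∀ i, f i ≅ g i) :
    IsDirectSumOf X g := by
  obtain ⟨p, s, h1, h2, h3⟩ := h
  refine ⟨fun i => p i ≫ (e i).hom, fun i => (e i).inv ≫ s i, ?_, ?_, ?_⟩
  · intro i
    simp [reassoc_of% (h1 i)]
  · intro i j hij
    simp [reassoc_of% (h2 i j hij)]
  · simpa using h3

lemma hasPdLT_of_gldimLE (n : ℕ) (hgl : gldimLE k A n) (X : ModuleCat.{u} A) :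
    HasProjectiveDimensionLT X (n + 1) := by
  letI : HasExt.{u} (ModuleCat.{u} A) := inferInstance
  refine HasProjectiveDimensionLT.mk ?_
  intro i hi Y e
  let R := projectiveResolution X
  obtain ⟨i, rfl⟩ : ∃ j, i = j + 1 := ⟨i - 1, by omega⟩
  obtain ⟨f, hf, rfl⟩ := R.extMk_surjective e (i + 2) rfl
  rw [R.extMk_eq_zero_iff _ _ _ _ i rfl]
  have h0 : Subsingleton (extGrp k A (i + 1) X Y) := hgl (i + 1) (by omega) X Y
  have hz : IsZero ((R.complex.linearYonedaObj k Y).homology (i + 1)) :=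
    (ModuleCat.isZero_of_subsingleton (extGrp k A (i + 1) X Y)).of_iso
      (R.isoExt (R := k) (i + 1) Y).symm
  rw [← HomologicalComplex.exactAt_iff_isZero_homology,
    HomologicalComplex.exactAt_iff' _ i (i + 1) (i + 2) (by simp) (by simp),
    ShortComplex.moduleCat_exact_iff] at hz
  obtain ⟨g, hg⟩ := hz f hf
  exact ⟨g, hg⟩

section general

variable {C : Type*} [Category C] [Abelian C]

lemma fromOpcycles_pOpcycles (K : CochainComplex C ℤ) (i : ℤ) :
    K.fromOpcycles i (i + 1) ≫ K.pOpcycles (i + 1) = 0 := by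
  simp [← cancel_epi (K.pOpcycles i)]

lemma exact_fromOpcycles_pOpcycles (K : CochainComplex C ℤ) (i : ℤ) :
    (ShortComplex.mk _ _ (fromOpcycles_pOpcycles K i)).Exact := by
  have h1 : (ShortComplex.mk _ _ (K.d_pOpcycles i (i + 1))).Exact :=
    ShortComplex.exact_of_g_is_cokernel _ (K.opcyclesIsCokernel i (i + 1) (by simp))
  let φ : ShortComplex.mk _ _ (K.d_pOpcycles i (i + 1)) ⟶
      ShortComplex.mk _ _ (fromOpcycles_pOpcycles K i) :=
    { τ₁ := K.pOpcycles i
      τ₂ := 𝟙 _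
      τ₃ := 𝟙 _ }
  have : Epi φ.τ₁ := inferInstanceAs (Epi (K.pOpcycles i))
  have : IsIso φ.τ₂ := inferInstanceAs (IsIso (𝟙 _))
  have : Mono φ.τ₃ := inferInstanceAs (Mono (𝟙 _))
  exact (ShortComplex.exact_iff_of_epi_of_isIso_of_mono φ).1 h1

lemma hasPdLT_kernel (K : CochainComplex C ℤ) (i : ℤ) (hP : Projective (K.X (i + 1))) (d : ℕ)
    (h : HasProjectiveDimensionLT (K.opcycles (i + 1)) (d + 2)) :
    HasProjectiveDimensionLT (kernel (K.pOpcycles (i + 1))) (d + 1) := by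
  have hS : (ShortComplex.mk (kernel.ι (K.pOpcycles (i + 1))) (K.pOpcycles (i + 1))
      (kernel.condition _)).ShortExact :=
    { exact := ShortComplex.exact_of_f_is_kernel _ (kernelIsKernel _)
      mono_f := inferInstanceAs (Mono (kernel.ι _))
      epi_g := inferInstanceAs (Epi (K.pOpcycles (i + 1))) }
  exact (hS.hasProjectiveDimensionLT_X₃_iff d hP).1 h

lemma hasPdLT_opcycles_step (K : CochainComplex C ℤ) (i : ℤ) (hP : Projective (K.X (i + 1)))
    (hH : IsZero (K.homology i)) (d : ℕ)
    (h : HasProjectiveDimensionLT (K.opcycles (i + 1)) (d + 2)) :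
    HasProjectiveDimensionLT (K.opcycles i) (d + 1) := by
  have : Mono (K.fromOpcycles i (i + 1)) :=
    Preadditive.mono_of_isZero_kernel' _ (K.homologyIsKernel i (i + 1) (by simp)) hH
  have hS : (ShortComplex.mk _ _ (fromOpcycles_pOpcycles K i)).ShortExact :=
    { exact := exact_fromOpcycles_pOpcycles K i
      mono_f := this
      epi_g := inferInstanceAs (Epi (K.pOpcycles (i + 1))) }
  exact (hS.hasProjectiveDimensionLT_X₃_iff d hP).1 h

lemma hasPdLT_opcycles (K : CochainComplex C ℤ) (hP : ∀ i, Projective (K.X i)) (n : ℕ)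
    (hgl : ∀ X : C, HasProjectiveDimensionLT X (n + 1)) (m : ℤ)
    (hH : ∀ i, m < i → i < m + n → IsZero (K.homology i)) (j : ℕ) (hj : j + 1 ≤ n) :
    HasProjectiveDimensionLT (K.opcycles (m + n - j)) (n - j + 1) := by
  induction j with
  | zero => exact hgl _
  | succ j ih =>
    have h := ih (by omega)
    obtain ⟨d, hd⟩ : ∃ d, n - j = d + 1 := ⟨n - j - 1, by omega⟩
    have e1 : n - (j + 1) + 1 = d + 1 := by omega
    have e2 : (m + n - (j : ℕ) : ℤ) = (m + n - ((j + 1 : ℕ) : ℤ)) + 1 := by push_cast; ring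
    rw [e1]
    rw [hd, e2] at h
    exact hasPdLT_opcycles_step K _ (hP _) (hH _ (by omega) (by push_cast; omega)) d h

lemma exists_retraction (K : CochainComplex C ℤ) (hP : ∀ i, Projective (K.X i)) (n : ℕ)
    (hn : 1 ≤ n)
    (hgl : ∀ X : C, HasProjectiveDimensionLT X (n + 1)) (m : ℤ)
    (hH : ∀ i, m < i → i < m + n → IsZero (K.homology i)) :
    ∃ r : K.opcycles m ⟶ K.homology m, K.homologyι m ≫ r = 𝟙 _ := by
  have h1 := hasPdLT_opcycles K hP n hgl m hH (n - 1) (by omega)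
  have e1 : n - (n - 1) + 1 = 0 + 2 := by omega
  have e2 : (m + n - ((n - 1 : ℕ) : ℤ)) = m + 1 := by omega
  rw [e1, e2] at h1
  have h2 := hasPdLT_kernel K m (hP _) 0 h1
  have h3 : Projective (kernel (K.pOpcycles (m + 1))) :=
    projective_iff_hasProjectiveDimensionLT_one.2 h2
  let l := kernel.lift (K.pOpcycles (m + 1)) (K.fromOpcycles m (m + 1))
    (fromOpcycles_pOpcycles K m)
  have hl : l ≫ kernel.ι _ = K.fromOpcycles m (m + 1) := kernel.lift_ι _ _ _
  have : Epi l := (exact_fromOpcycles_pOpcycles K m).epi_kernelLift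
  let σ := Projective.factorThru (𝟙 _) l
  have hσ : σ ≫ l = 𝟙 _ := Projective.factorThru_comp _ _
  have hz : (𝟙 _ - l ≫ σ) ≫ K.fromOpcycles m (m + 1) = 0 := by
    rw [← hl, Preadditive.sub_comp]
    simp [reassoc_of% hσ]
  have hker := K.homologyIsKernel m (m + 1) (by simp)
  obtain ⟨r, hr⟩ := KernelFork.IsLimit.lift' hker _ hz
  have hr' : r ≫ K.homologyι m = 𝟙 _ - l ≫ σ := hr
  refine ⟨r, ?_⟩
  have hil : K.homologyι m ≫ l = 0 := by
    rw [← cancel_mono (kernel.ι _), Category.assoc, hl]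
    simp
  rw [← cancel_mono (K.homologyι m), Category.assoc, hr', Preadditive.comp_sub, reassoc_of% hil]
  simp

lemma exists_toSingle (K : CochainComplex C ℤ) (m : ℤ)
    (h : ∃ r : K.opcycles m ⟶ K.homology m, K.homologyι m ≫ r = 𝟙 _) :
    ∃ f : K ⟶ (HomologicalComplex.single C (ComplexShape.up ℤ) m).obj (K.homology m),
      IsIso (HomologicalComplex.homologyMap f m) := by
  obtain ⟨r, hr⟩ := h
  let f := HomologicalComplex.mkHomToSingle (K := K) (j := m) (K.pOpcycles m ≫ r)
    (by intro i hi; simp)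
  refine ⟨f, ?_⟩
  have h1 : HomologicalComplex.opcyclesMap f m =
      r ≫ (HomologicalComplex.singleObjOpcyclesSelfIso _ _ _).hom := by
    rw [← cancel_epi (K.pOpcycles m), HomologicalComplex.p_opcyclesMap,
      HomologicalComplex.singleObjOpcyclesSelfIso_hom]
    simp [f]
  have h2 : HomologicalComplex.homologyMap f m ≫
      (HomologicalComplex.singleObjHomologySelfIso _ _ _).hom = 𝟙 _ := by
    rw [← HomologicalComplex.homologyι_singleObjOpcyclesSelfIso_inv,
      HomologicalComplex.homologyι_naturality_assoc, h1]
    simp [hr]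
  have h3 : HomologicalComplex.homologyMap f m =
      (HomologicalComplex.singleObjHomologySelfIso _ _ _).inv := by
    rw [← cancel_mono (HomologicalComplex.singleObjHomologySelfIso _ _ _).hom, h2]
    simp
  rw [h3]
  infer_instance

instance hasFinBiprodCochain {C : Type*} [Category C] [Abelian C] :
    HasFiniteBiproducts (CochainComplex C ℤ) :=
  HasFiniteBiproducts.of_hasFiniteProducts

lemma isIso_homologyMap_π {ι : Type} [Fintype ι] (L : ι → CochainComplex C ℤ) (i : ℤ) (l : ι)
    (hL : ∀ j, j ≠ l → IsZero ((L j).homology i)) :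
    IsIso (HomologicalComplex.homologyMap (biproduct.π L l) i) := by
  classical
  refine ⟨HomologicalComplex.homologyMap (biproduct.ι L l) i, ?_, ?_⟩
  · have h := congrArg (fun f => (HomologicalComplex.homologyFunctor C
      (ComplexShape.up ℤ) i).map f) (biproduct.total (f := L))
    simp only [Functor.map_sum, Functor.map_comp, CategoryTheory.Functor.map_id] at h
    rw [Finset.sum_eq_single l] at h
    · exact h
    · intro j _ hj
      exact (show (HomologicalComplex.homologyFunctor C (ComplexShape.up ℤ) i).map
        (biproduct.π L j) = 0 from (hL j hj).eq_of_tgt _ _) ▸ zero_comp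
    · simp
  · rw [← HomologicalComplex.homologyMap_comp, biproduct.ι_π_self,
      HomologicalComplex.homologyMap_id]

lemma isZero_homology_biproduct {ι : Type} [Fintype ι] (L : ι → CochainComplex C ℤ) (i : ℤ)
    (hL : ∀ j, IsZero ((L j).homology i)) :
    IsZero ((⨁ L).homology i) := by
  classical
  rw [IsZero.iff_id_eq_zero]
  have h := congrArg (fun f => (HomologicalComplex.homologyFunctor C
      (ComplexShape.up ℤ) i).map f) (biproduct.total (f := L))
  simp only [Functor.map_sum, Functor.map_comp, CategoryTheory.Functor.map_id] at h
  refine h.symm.trans (Finset.sum_eq_zero ?_)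
  intro j _
  exact (show (HomologicalComplex.homologyFunctor C (ComplexShape.up ℤ) i).map
        (biproduct.π L j) = 0 from (hL j).eq_of_tgt _ _) ▸ zero_comp

lemma quasiIso_lift {ι : Type} [Fintype ι] (K : CochainComplex C ℤ) (c : ι → ℤ)
    (hc : Function.Injective c) (Y : ι → C)
    (f : ∀ l, K ⟶ (HomologicalComplex.single C (ComplexShape.up ℤ) (c l)).obj (Y l))
    (hf : ∀ l, IsIso (HomologicalComplex.homologyMap (f l) (c l)))
    (hK : ∀ i, (∀ l, i ≠ c l) → IsZero (K.homology i)) :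
    QuasiIso (biproduct.lift f) := by
  rw [quasiIso_iff]
  intro i
  rw [quasiIsoAt_iff_isIso_homologyMap]
  by_cases hi : ∃ l, i = c l
  · obtain ⟨l, rfl⟩ := hi
    have h1 := isIso_homologyMap_π
      (fun l => (HomologicalComplex.single C (ComplexShape.up ℤ) (c l)).obj (Y l)) (c l) l
      (fun j hj => HomologicalComplex.isZero_single_obj_homology _ _ _ _
        (fun h => hj (hc h).symm))
    have h2 := hf l
    rw [← biproduct.lift_π f l, HomologicalComplex.homologyMap_comp] at h2
    exact IsIso.of_isIso_comp_right _ (HomologicalComplex.homologyMap (biproduct.π _ l) (c l))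
  · push Not at hi
    have h1 := isZero_homology_biproduct
      (fun l => (HomologicalComplex.single C (ComplexShape.up ℤ) (c l)).obj (Y l)) i
      (fun j => HomologicalComplex.isZero_single_obj_homology _ _ _ _ (hi j))
    exact (isIso_of_source_target_iso_zero _ ((hK i hi).isoZero) h1.isoZero)

lemma isDirectSumOf_Q {ι : Type} [Fintype ι] [HasDerivedCategory C] (K : CochainComplex C ℤ)
    (L : ι → CochainComplex C ℤ) (f : ∀ l, K ⟶ L l) (h : QuasiIso (biproduct.lift f)) :
    IsDirectSumOf (DerivedCategory.Q.obj K) (fun l => DerivedCategory.Q.obj (L l)) := by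
  classical
  let F := DerivedCategory.Q.map (biproduct.lift f)
  have : IsIso F := inferInstanceAs (IsIso (DerivedCategory.Q.map (biproduct.lift f)))
  have hF : ∀ l, DerivedCategory.Q.map (f l) = F ≫ DerivedCategory.Q.map (biproduct.π L l) := by
    intro l
    rw [← Functor.map_comp, biproduct.lift_π]
  refine ⟨fun l => DerivedCategory.Q.map (f l),
    fun l => DerivedCategory.Q.map (biproduct.ι L l) ≫ inv F, ?_, ?_, ?_⟩
  · intro l
    beta_reduce
    rw [hF, Category.assoc, IsIso.inv_hom_id_assoc, ← Functor.map_comp, biproduct.ι_π_self,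
      CategoryTheory.Functor.map_id]
  · intro i j hij
    beta_reduce
    rw [hF, Category.assoc, IsIso.inv_hom_id_assoc, ← Functor.map_comp, biproduct.ι_π_ne _ hij,
      Functor.map_zero]
  · have h := congrArg (fun f => DerivedCategory.Q.map f) (biproduct.total (f := L))
    simp only [Functor.map_sum, Functor.map_comp, CategoryTheory.Functor.map_id] at h
    have h2 : ∀ l, DerivedCategory.Q.map (f l) ≫ DerivedCategory.Q.map (biproduct.ι L l) ≫ inv F
      = F ≫ (DerivedCategory.Q.map (biproduct.π L l) ≫
        DerivedCategory.Q.map (biproduct.ι L l)) ≫ inv F := by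
      intro l
      rw [hF]
      simp only [Category.assoc]
    simp only [h2]
    rw [← Preadditive.comp_sum, ← Preadditive.sum_comp, h]
    simp

end general

/-- If `gl.dim A ≤ n` and `X ∈ K^b(proj A)` has `H^i(X) = 0` for all `i` not
divisible by `n`, then `X` is isomorphic in the derived category to the direct
sum of its (finitely many nonzero) cohomologies `H^{ℓn}(X)[-ℓn]`. -/
theorem decomposition_into_shifted_cohomologies
    [FiniteDimensional k A] (n : ℕ) (hn : 1 ≤ n) (hgl : gldimLE k A n)
    (P : CochainComplex (ModuleCat.{u} A) ℤ)
    (hproj : ∀ i : ℤ, Projective (P.X i))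
    (hbdd : ∃ a b : ℤ, ∀ i : ℤ, (i < a ∨ b < i) → IsZero (P.X i))
    (hH : ∀ i : ℤ, ¬ ((n : ℤ) ∣ i) →
      IsZero ((Hq A i).obj (DerivedCategory.Q.obj P))) :
    ∃ a b : ℤ,
      (∀ ℓ : ℤ, ℓ ∉ Finset.Icc a b →
        IsZero ((Hq A (ℓ * n)).obj (DerivedCategory.Q.obj P))) ∧
      IsDirectSumOf (DerivedCategory.Q.obj P)
        (fun ℓ : ↥(Finset.Icc a b) =>
          (DerivedCategory.singleFunctor (ModuleCat.{u} A) ((ℓ : ℤ) * n)).obj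
            ((Hq A ((ℓ : ℤ) * n)).obj (DerivedCategory.Q.obj P))) := by
  obtain ⟨a0, b0, hz⟩ := hbdd
  have eH : ∀ i : ℤ, (Hq A i).obj (DerivedCategory.Q.obj P) ≅ P.homology i := fun i =>
    (DerivedCategory.homologyFunctorFactors (ModuleCat.{u} A) i).app P
  have hH' : ∀ i : ℤ, ¬ ((n : ℤ) ∣ i) → IsZero (P.homology i) := fun i hi =>
    (hH i hi).of_iso (eH i).symm
  have hz' : ∀ i : ℤ, (i < a0 ∨ b0 < i) → IsZero (P.homology i) := fun i hi => by
    rw [← HomologicalComplex.exactAt_iff_isZero_homology]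
    exact ShortComplex.exact_of_isZero_X₂ _ (hz i hi)
  have hpd := hasPdLT_of_gldimLE k A n hgl
  have hn' : (1 : ℤ) ≤ n := by exact_mod_cast hn
  have hout : ∀ ℓ : ℤ, ℓ ∉ Finset.Icc (-|a0|) |b0| → IsZero (P.homology (ℓ * n)) := by
    intro ℓ hℓ
    apply hz'
    rw [Finset.mem_Icc, not_and_or, not_le, not_le] at hℓ
    rcases hℓ with hℓ | hℓ
    · left
      have h1 := neg_abs_le a0
      have h2 := abs_nonneg a0
      nlinarith
    · right
      have h1 := le_abs_self b0
      have h2 := abs_nonneg b0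
      nlinarith
  refine ⟨-|a0|, |b0|, fun ℓ hℓ => (hout ℓ hℓ).of_iso (eH _), ?_⟩
  have hex : ∀ ℓ : ↥(Finset.Icc (-|a0|) |b0|),
      ∃ f : P ⟶ (HomologicalComplex.single _ (ComplexShape.up ℤ) ((ℓ : ℤ) * n)).obj
        (P.homology ((ℓ : ℤ) * n)),
      IsIso (HomologicalComplex.homologyMap f ((ℓ : ℤ) * n)) := by
    intro ℓ
    refine exists_toSingle P _ (exists_retraction P hproj n hn hpd _ ?_)
    intro i h1 h2
    refine hH' i ?_
    rintro ⟨q, rfl⟩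
    have h3 : (ℓ : ℤ) < q := by nlinarith
    have h4 : q < (ℓ : ℤ) + 1 := by nlinarith
    omega
  choose f hf using hex
  have hq : QuasiIso (biproduct.lift f) := by
    refine quasiIso_lift P (fun ℓ : ↥(Finset.Icc (-|a0|) |b0|) => (ℓ : ℤ) * n) ?_ _ f hf ?_
    · intro x y hxy
      have : (x : ℤ) = y := mul_right_cancel₀ (by omega : (n : ℤ) ≠ 0) hxy
      exact Subtype.ext this
    · intro i hi
      by_cases hd : (n : ℤ) ∣ i
      · obtain ⟨q, rfl⟩ := hd
        rw [mul_comm]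
        apply hout
        intro hq
        exact hi ⟨q, hq⟩ (mul_comm _ _)
      · exact hH' i hd
  refine isDirectSumOf_congr (isDirectSumOf_Q P _ f hq) ?_
  intro ℓ
  exact (DerivedCategory.singleFunctor (ModuleCat.{u} A) ((ℓ : ℤ) * n)).mapIso (eH _).symm
end
end
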